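/- (Regular quantum-classical correspondence.) Let G = (X,E) be a finite connected graph without dead ends and z ∈ ℂ ∖ {−1,0,1}. Then the three complex vector spaces E_{χ(z)}(Δ; Maps(X,ℂ)), E_z(L; C^lc(𝔓)) and E_z(L'; D'(𝔓)) are pairwise linearly isomorphic. -/

import Mathlib

open Function Set
open scoped Classical

namespace GraphQCC

variable {X : Type} (G : SimpleGraph X)

/-- The set of directed edges of a (symmetric, loopless) graph. -/
abbrev DE := {p : X × X // G.Adj p.1 p.2}

variable {G}

/-- Initial vertex of a directed edge. -/
def ini (e : DE G) : X := e.1.1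

/-- Terminal vertex of a directed edge. -/
def ter (e : DE G) : X := e.1.2

/-- Opposite edge. -/
def op (e : DE G) : DE G := ⟨(e.1.2, e.1.1), e.2.symm⟩

variable (G)

/-- Degree of a vertex: the number of directed edges starting at it. -/
noncomputable def deg (x : X) : ℕ := Set.ncard {e : DE G | ini e = x}

/-- The graph is locally finite: every vertex has finite degree. -/
def LocFin : Prop := ∀ x : X, {e : DE G | ini e = x}.Finite

/-- The edge Laplacian. -/
noncomputable def edgeLap (f : DE G → ℂ) (e : DE G) : ℂ :=
  ∑ᶠ e' ∈ {e' : DE G | ini e' = ter e ∧ e' ≠ op e}, f e'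

/-- The `z`-eigenspace of the edge Laplacian, as a set of functions on directed edges. -/
def edgeEig (z : ℂ) : Set (DE G → ℂ) := {f | ∀ e, edgeLap G f e = z * f e}

/-- The edge inversion operator Ξ. -/
def Xi (f : DE G → ℂ) (e : DE G) : ℂ := f (op e)

/-- The operator Σ (sum over edges with the same initial point). -/
noncomputable def Sig (f : DE G → ℂ) (e : DE G) : ℂ :=
  ∑ᶠ e' ∈ {e' : DE G | ini e' = ini e}, f e'

/-- Edges pointing away from a vertex `o`. -/
def away (o : X) : Set (DE G) := {e | G.dist o (ter e) = G.dist o (ini e) + 1}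

/-- The edge Laplacian on functions on the edges pointing away from `o`. -/
noncomputable def edgeLapAway (o : X) (f : ↥(away G o) → ℂ) (e : ↥(away G o)) : ℂ :=
  ∑ᶠ e' ∈ {e' : ↥(away G o) | ini e'.1 = ter e.1 ∧ e'.1 ≠ op e.1}, f e'

/-- The `z`-eigenspace of the edge Laplacian on edges pointing away from `o`. -/
def edgeEigAway (o : X) (z : ℂ) : Set (↥(away G o) → ℂ) :=
  {f | ∀ e, edgeLapAway G o f e = z * f e}

/-! ## Boundary at infinity -/

/-- A ray: an infinite non-backtracking chain of vertices. -/
def IsRay (r : ℕ → X) : Prop := (∀ n, G.Adj (r n) (r (n + 1))) ∧ ∀ n, r (n + 2) ≠ r n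

abbrev Ray := {r : ℕ → X // IsRay G r}

/-- Two rays are equivalent if they share infinitely many vertices. -/
def RayRel (r r' : Ray G) : Prop := (Set.range r.1 ∩ Set.range r'.1).Infinite

/-- The boundary at infinity: equivalence classes of rays. -/
def Boundary := Quot (RayRel G)

/-- The set `∂₊ e` of boundary points reachable by a non-backtracking chain starting with `e`. -/
def plusBd (e : DE G) : Set (Boundary G) :=
  {ω | ∃ r : Ray G, Quot.mk (RayRel G) r = ω ∧ r.1 0 = ini e ∧ r.1 1 = ter e}

/-- The topology on the boundary generated by the sets `∂₊ e`. -/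
instance : TopologicalSpace (Boundary G) :=
  TopologicalSpace.generateFrom {s | ∃ e : DE G, s = plusBd G e}

/-- The space of locally constant functions on the boundary. -/
noncomputable def Clc : Submodule ℂ (Boundary G → ℂ) where
  carrier := {f | IsLocallyConstant f}
  add_mem' hf hg := hf.comp₂ hg (· + ·)
  zero_mem' := IsLocallyConstant.const 0
  smul_mem' c f hf := hf.comp (c * ·)

/-- `D'(Ω)`: the algebraic dual of the space of locally constant functions on the boundary. -/
abbrev DualB := Module.Dual ℂ ↥(Clc G)

/-- Pairing of a functional on `C^lc(Ω)` with a function on the boundary. -/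
noncomputable def pairB (μ : DualB G) (g : Boundary G → ℂ) : ℂ :=
  if h : IsLocallyConstant g then μ ⟨g, h⟩ else 0

/-- The horocycle bracket `⟨x, ω⟩` with respect to the base point `o`: the unique integer `k`
such that `d(x, r n) = n - k` for every ray `r` from `o` representing `ω` and all large `n`. -/
noncomputable def horo (o x : X) (ω : Boundary G) : ℤ :=
  if h : ∃ k : ℤ, ∀ r : Ray G, Quot.mk (RayRel G) r = ω → r.1 0 = o →
      ∃ N : ℕ, ∀ n : ℕ, N ≤ n → (G.dist x (r.1 n) : ℤ) = (n : ℤ) - k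
  then h.choose else 0

/-- The scalar Poisson transform. -/
noncomputable def poisson (o : X) (z : ℂ) (μ : DualB G) (x : X) : ℂ :=
  pairB G μ fun ω => z ^ horo G o x ω

/-- The edge Poisson transform. -/
noncomputable def edgePoisson (o : X) (z : ℂ) (μ : DualB G) (e : DE G) : ℂ :=
  pairB G μ fun ω => z ^ horo G o (ini e) ω * Set.indicator (plusBd G e) 1 ω

/-! ## The shift space of non-backtracking chains of edges -/

/-- An infinite concatenated non-backtracking sequence of directed edges. -/
def IsChainSeq (c : ℕ → DE G) : Prop :=
  ∀ i, ter (c i) = ini (c (i + 1)) ∧ ter (c (i + 1)) ≠ ini (c i)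

/-- The shift space `𝔓`. -/
abbrev ChainSp := {c : ℕ → DE G // IsChainSeq G c}

/-- The one-sided shift on chains. -/
def shift (c : ChainSp G) : ChainSp G := ⟨fun n => c.1 (n + 1), fun i => c.2 (i + 1)⟩

/-- The district (cylinder) topology on the shift space. -/
instance : TopologicalSpace (ChainSp G) :=
  TopologicalSpace.generateFrom
    {s | ∃ (c₀ : ChainSp G) (n : ℕ), s = {c : ChainSp G | ∀ i ≤ n, c.1 i = c₀.1 i}}

/-- The Ruelle transfer operator. -/
noncomputable def transfer (F : ChainSp G → ℂ) (c : ChainSp G) : ℂ :=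
  ∑ᶠ c' ∈ {c' : ChainSp G | shift G c' = c}, F c'

/-- Functions on chains depending only on the first `N` edges. -/
def cylFun (N : ℕ) : Set (ChainSp G → ℂ) :=
  {F | ∀ c c' : ChainSp G, (∀ i < N, c.1 i = c'.1 i) → F c = F c'}

/-- The ray of initial vertices of a chain of edges. -/
def toRay (c : ChainSp G) : Ray G :=
  ⟨fun n => ini (c.1 n), by
    refine ⟨fun n => ?_, fun n => ?_⟩
    · have h1 : ter (c.1 n) = ini (c.1 (n + 1)) := (c.2 n).1
      have h2 : G.Adj (ini (c.1 n)) (ter (c.1 n)) := (c.1 n).2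
      rwa [h1] at h2
    · have h1 : ter (c.1 (n + 1)) = ini (c.1 (n + 2)) := (c.2 (n + 1)).1
      have h2 : ter (c.1 (n + 1)) ≠ ini (c.1 n) := (c.2 n).2
      rwa [h1] at h2⟩

/-- The endpoint map `B : 𝔓 → Ω`. -/
def endB (c : ChainSp G) : Boundary G := Quot.mk (RayRel G) (toRay G c)

/-- The pushforward `B_⋆` by fiber summation. -/
noncomputable def push (f : ChainSp G → ℂ) (ω : Boundary G) : ℂ :=
  ∑ᶠ c ∈ {c : ChainSp G | endB G c = ω}, f c

/-- The space of locally constant compactly supported functions on the shift space. -/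
noncomputable def CcP : Submodule ℂ (ChainSp G → ℂ) where
  carrier := {F | IsLocallyConstant F ∧ HasCompactSupport F}
  add_mem' hf hg := ⟨hf.1.comp₂ hg.1 (· + ·), hf.2.add hg.2⟩
  zero_mem' := ⟨IsLocallyConstant.const 0, HasCompactSupport.zero⟩
  smul_mem' c f hf := ⟨hf.1.comp (c * ·),
    hf.2.mono fun x hx h0 => hx (by simp [h0])⟩

/-- `D'(𝔓)`: the algebraic dual of `C^lc_c(𝔓)`. -/
abbrev DualP := Module.Dual ℂ ↥(CcP G)

/-- Pairing of a functional on `C^lc_c(𝔓)` with a function on the shift space. -/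
noncomputable def pairP (lam : DualP G) (g : ChainSp G → ℂ) : ℂ :=
  if h : g ∈ CcP G then lam ⟨g, h⟩ else 0

/-- The space of locally constant functions on the shift space (for finite graphs this is
`C^lc_c(𝔓)` since `𝔓` is compact). -/
noncomputable def ClcP : Submodule ℂ (ChainSp G → ℂ) where
  carrier := {F | IsLocallyConstant F}
  add_mem' hf hg := hf.comp₂ hg (· + ·)
  zero_mem' := IsLocallyConstant.const 0
  smul_mem' c f hf := hf.comp (c * ·)

/-- The dual of `C^lc(𝔓)`. -/
abbrev DualPc := Module.Dual ℂ ↥(ClcP G)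

/-- Pairing of a functional on `C^lc(𝔓)` with a function on the shift space. -/
noncomputable def pairPc (lam : DualPc G) (g : ChainSp G → ℂ) : ℂ :=
  if h : IsLocallyConstant g then lam ⟨g, h⟩ else 0

/-! ## Vertex Laplacian -/

/-- The vertex Laplacian (averaging over neighbors). -/
noncomputable def vertexLap (f : X → ℂ) (x : X) : ℂ :=
  ((deg G x : ℂ))⁻¹ * ∑ᶠ e ∈ {e : DE G | ini e = x}, f (ter e)

/-- The function `χ(z)(x) = (z + q_x z⁻¹)/(q_x + 1)`. -/
noncomputable def chi (z : ℂ) (x : X) : ℂ :=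
  (z + ((deg G x : ℂ) - 1) * z⁻¹) / (deg G x : ℂ)

/-- The `χ(z)`-eigenspace of the vertex Laplacian. -/
def vertexEig (z : ℂ) : Set (X → ℂ) := {f | ∀ x, vertexLap G f x = chi G z x * f x}

/-! ## Miscellaneous -/

/-- Two subsets of complex vector spaces (in practice: subspaces) are linearly isomorphic. -/
def AreLinIso {M N : Type} [AddCommMonoid M] [Module ℂ M] [AddCommMonoid N] [Module ℂ N]
    (A : Set M) (B : Set N) : Prop :=
  ∃ F : M → N, Set.BijOn F A B ∧ (∀ a ∈ A, ∀ b ∈ A, F (a + b) = F a + F b) ∧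
    ∀ (c : ℂ), ∀ a ∈ A, F (c • a) = c • F a

/-- The `z`-eigenspace of the edge Laplacian as a submodule (for a locally finite graph). -/
noncomputable def edgeEigSub (hlf : LocFin G) (z : ℂ) : Submodule ℂ (DE G → ℂ) where
  carrier := edgeEig G z
  add_mem' := by
    intro f g hf hg e
    have hS : {e' : DE G | ini e' = ter e ∧ e' ≠ op e}.Finite :=
      (hlf (ter e)).subset fun _ h => h.1
    have : edgeLap G (f + g) e = edgeLap G f e + edgeLap G g e := by
      simpa [edgeLap] using finsum_mem_add_distrib (f := f) (g := g) hS
    rw [this, hf e, hg e, Pi.add_apply, mul_add]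
  zero_mem' := by
    intro e
    simp [edgeLap]
  smul_mem' := by
    intro c f hf e
    have hS : {e' : DE G | ini e' = ter e ∧ e' ≠ op e}.Finite :=
      (hlf (ter e)).subset fun _ h => h.1
    have : edgeLap G (c • f) e = c * edgeLap G f e := by
      simp only [edgeLap, Pi.smul_apply, smul_eq_mul]
      rw [finsum_mem_eq_finite_toFinset_sum _ hS, finsum_mem_eq_finite_toFinset_sum _ hS,
        Finset.mul_sum]
    rw [Pi.smul_apply, smul_eq_mul, this, hf e]; ring

/-- The cyclomatic number of a finite graph, as an integer. -/
noncomputable def cyclo : ℤ := (Nat.card G.edgeSet : ℤ) - (Nat.card X : ℤ) + 1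

/-- 2-colorability. -/
def TwoColorable : Prop := ∃ col : X → Bool, ∀ x y : X, G.Adj x y → col x ≠ col y


/-! ## Linear algebra -/

section LinearAlgebra

open LinearMap

variable {K V : Type*} [Field K] [AddCommGroup V] [Module K V]

/-- If `U` is `L`-stable and contains `L v - z v`, then it contains `L ^ n v - z ^ n v`. -/
lemma pow_apply_sub_mem (L : V →ₗ[K] V) (U : Submodule K V) (hU : ∀ u ∈ U, L u ∈ U) {z : K}
    {v : V} (hv : L v - z • v ∈ U) (n : ℕ) : (L ^ n) v - z ^ n • v ∈ U := by
  induction n with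
  | zero => simp
  | succ n ih =>
    have h : (L ^ (n + 1)) v - z ^ (n + 1) • v
        = L ((L ^ n) v - z ^ n • v) + z ^ n • (L v - z • v) := by
      rw [pow_succ' L, Module.End.mul_apply, map_sub, map_smul, smul_sub, smul_smul, pow_succ]
      abel
    rw [h]
    exact U.add_mem (hU _ ih) (U.smul_mem _ hv)

/-- If `L` is eventually absorbed by a finite-dimensional stable subspace, then for `z ≠ 0` the
`z`-eigenspaces of `L` and of its transpose are isomorphic. -/
lemma nonempty_ker_equiv_ker_dualMap (L : V →ₗ[K] V) (W : Submodule K V) [FiniteDimensional K W]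
    (hW : ∀ w ∈ W, L w ∈ W) (hL : ∀ v, ∃ n, (L ^ n) v ∈ W) {z : K} (hz : z ≠ 0) :
    Nonempty (ker (L - z • LinearMap.id) ≃ₗ[K] ker (L - z • LinearMap.id).dualMap) := by
  set A : V →ₗ[K] V := L - z • LinearMap.id with hA
  have hAv : ∀ v, A v = L v - z • v := fun v => by simp [hA]
  have hWA : ∀ w ∈ W, A w ∈ W := fun w hw => by
    rw [hAv]
    exact W.sub_mem (hW w hw) (W.smul_mem _ hw)
  have mem_of_apply_mem : ∀ v, A v ∈ W → v ∈ W := fun v hv => by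
    obtain ⟨n, hn⟩ := hL v
    rw [hAv] at hv
    have h := W.sub_mem hn (pow_apply_sub_mem L W hW hv n)
    rw [sub_sub_cancel] at h
    exact (W.smul_mem_iff (pow_ne_zero n hz)).1 h
  let AW : W →ₗ[K] W := A.restrict hWA
  let q : W →ₗ[K] V ⧸ LinearMap.range A := (LinearMap.range A).mkQ ∘ₗ W.subtype
  have hq : Surjective q := by
    intro y
    obtain ⟨v, rfl⟩ := (LinearMap.range A).mkQ_surjective y
    obtain ⟨n, hn⟩ := hL v
    have hR : ∀ u ∈ LinearMap.range A, L u ∈ LinearMap.range A := by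
      rintro _ ⟨u, rfl⟩
      exact ⟨L u, by simp [hAv]⟩
    have h := pow_apply_sub_mem L (LinearMap.range A) hR (hAv v ▸ LinearMap.mem_range_self A v) n
    refine ⟨⟨(z ^ n)⁻¹ • (L ^ n) v, W.smul_mem _ hn⟩, ?_⟩
    refine (Submodule.Quotient.eq _).2 ?_
    have h' := (LinearMap.range A).smul_mem (z ^ n)⁻¹ h
    rwa [smul_sub, inv_smul_smul₀ (pow_ne_zero n hz)] at h'
  have hker : ker q = LinearMap.range AW := by
    ext w
    simp only [q, mem_ker, coe_comp, comp_apply, Submodule.subtype_apply, Submodule.mkQ_apply,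
      Submodule.Quotient.mk_eq_zero, LinearMap.mem_range]
    constructor
    · rintro ⟨v, hv⟩
      exact ⟨⟨v, mem_of_apply_mem v (hv ▸ w.2)⟩, Subtype.ext hv⟩
    · rintro ⟨v, rfl⟩
      exact ⟨v, rfl⟩
  let eq : (W ⧸ LinearMap.range AW) ≃ₗ[K] V ⧸ LinearMap.range A :=
    (Submodule.quotEquivOfEq _ _ hker.symm).trans (quotKerEquivOfSurjective q hq)
  have hle : ker A ≤ W := fun v hv => mem_of_apply_mem v (by rw [mem_ker.1 hv]; exact W.zero_mem)
  have hkerAW : ker AW = (ker A).comap W.subtype := by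
    ext w
    simp [AW, Subtype.ext_iff]
  let ek : ker AW ≃ₗ[K] ker A :=
    (LinearEquiv.ofEq _ _ hkerAW).trans (Submodule.comapSubtypeEquivOfLe hle)
  have : FiniteDimensional K (V ⧸ LinearMap.range A) := Module.Finite.equiv eq
  have hdim : Module.finrank K (ker AW) = Module.finrank K (Module.Dual K (V ⧸ LinearMap.range A)) := by
    rw [Subspace.dual_finrank_eq, ← eq.finrank_eq]
    have h₁ := AW.finrank_range_add_finrank_ker
    have h₂ := (LinearMap.range AW).finrank_quotient_add_finrank
    omega
  exact ⟨ek.symm.trans <| (LinearEquiv.ofFinrankEq _ _ hdim).trans <|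
    (LinearMap.range A).dualQuotEquivDualAnnihilator.trans <|
    LinearEquiv.ofEq _ _ A.ker_dualMap_eq_dualAnnihilator_range.symm⟩

end LinearAlgebra

section AreLinIso

variable {M N P : Type} [AddCommGroup M] [Module ℂ M] [AddCommGroup N] [Module ℂ N]
  [AddCommGroup P] [Module ℂ P]

lemma AreLinIso.trans {A : Set M} {B : Set N} {C : Set P} (h : AreLinIso A B)
    (h' : AreLinIso B C) : AreLinIso A C := by
  obtain ⟨F, hF, hadd, hsmul⟩ := h
  obtain ⟨F', hF', hadd', hsmul'⟩ := h'
  refine ⟨F' ∘ F, hF'.comp hF, fun a ha b hb => ?_, fun c a ha => ?_⟩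
  · simp only [comp_apply, hadd a ha b hb, hadd' _ (hF.mapsTo ha) _ (hF.mapsTo hb)]
  · simp only [comp_apply, hsmul c a ha, hsmul' c _ (hF.mapsTo ha)]

lemma areLinIso_of_equiv {A : Submodule ℂ M} {B : Submodule ℂ N} (e : A ≃ₗ[ℂ] B) :
    AreLinIso (A : Set M) (B : Set N) := by
  have hF : ∀ a (ha : a ∈ A), (if h : a ∈ A then (e ⟨a, h⟩ : N) else 0) = e ⟨a, ha⟩ :=
    fun a ha => dif_pos ha
  refine ⟨fun a => if h : a ∈ A then (e ⟨a, h⟩ : N) else 0, ⟨?_, ?_, ?_⟩, ?_, ?_⟩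
  · intro a ha
    simp only [hF a ha, SetLike.mem_coe, SetLike.coe_mem]
  · intro a ha b hb hab
    simp only [hF a ha, hF b hb] at hab
    simpa using e.injective (Subtype.ext hab)
  · intro b hb
    refine ⟨e.symm ⟨b, hb⟩, (e.symm ⟨b, hb⟩).2, ?_⟩
    exact (hF _ (e.symm ⟨b, hb⟩).2).trans (by simp)
  · intro a ha b hb
    simp only [hF a ha, hF b hb, hF _ (A.add_mem ha hb)]
    rw [← Submodule.coe_add, ← map_add]
    rfl
  · intro c a ha
    simp only [hF a ha, hF _ (A.smul_mem c ha)]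
    rw [← Submodule.coe_smul, ← map_smul]
    rfl

end AreLinIso

/-! ## Chains and the transfer operator -/

section Chains

variable {G}

@[simp] lemma ini_op (e : DE G) : ini (op e) = ter e := rfl

@[simp] lemma ter_op (e : DE G) : ter (op e) = ini e := rfl

@[simp] lemma op_op (e : DE G) : op (op e) = e := rfl

lemma edge_ext {e e' : DE G} (h : ini e = ini e') (h' : ter e = ter e') : e = e' :=
  Subtype.ext (Prod.ext h h')

/-- Prepend an edge to a chain. -/
def cons (e : DE G) (c : ChainSp G) (h : ter e = ini (c.1 0) ∧ ter (c.1 0) ≠ ini e) :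
    ChainSp G :=
  ⟨fun n => Nat.casesOn n e c.1, fun i => by
    cases i with
    | zero => exact h
    | succ i => exact c.2 i⟩

lemma transfer_eq_sum [Fintype (DE G)] (F : ChainSp G → ℂ) (c : ChainSp G) :
    transfer G F c =
      ∑ e : DE G, if h : ter e = ini (c.1 0) ∧ ter (c.1 0) ≠ ini e then F (cons e c h) else 0 := by
  have hbij : Set.BijOn (fun c' : ChainSp G => c'.1 0) {c' | shift G c' = c}
      {e | ter e = ini (c.1 0) ∧ ter (c.1 0) ≠ ini e} := by
    refine ⟨?_, ?_, ?_⟩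
    · rintro c' rfl
      exact c'.2 0
    · rintro c₁ h₁ c₂ h₂ h
      refine Subtype.ext (funext fun n => ?_)
      cases n with
      | zero => exact h
      | succ n => exact congrFun (congrArg Subtype.val (h₁.trans h₂.symm)) n
    · intro e he
      exact ⟨cons e c he, rfl, rfl⟩
  rw [transfer, finsum_mem_eq_of_bijOn _ hbij (g := fun e =>
    if h : ter e = ini (c.1 0) ∧ ter (c.1 0) ≠ ini e then F (cons e c h) else 0), finsum_mem_def,
    finsum_eq_sum_of_fintype]
  · refine Finset.sum_congr rfl fun e _ => ?_
    by_cases h : ter e = ini (c.1 0) ∧ ter (c.1 0) ≠ ini e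
    · exact Set.indicator_of_mem (s := {e | ter e = ini (c.1 0) ∧ ter (c.1 0) ≠ ini e}) h _
    · rw [dif_neg h]
      exact Set.indicator_of_notMem (s := {e | ter e = ini (c.1 0) ∧ ter (c.1 0) ≠ ini e}) h _
  · rintro c' rfl
    refine Eq.trans ?_ (dif_pos (c'.2 0)).symm
    refine congrArg F (Subtype.ext (funext fun n => ?_))
    cases n <;> rfl

lemma transfer_mem_cylFun [Fintype (DE G)] {F : ChainSp G → ℂ} {n : ℕ}
    (hF : F ∈ cylFun G (n + 2)) : transfer G F ∈ cylFun G (n + 1) := by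
  intro c c' h
  rw [transfer_eq_sum, transfer_eq_sum]
  refine Finset.sum_congr rfl fun e _ => ?_
  have h₀ : c.1 0 = c'.1 0 := h 0 n.succ_pos
  by_cases hc : ter e = ini (c.1 0) ∧ ter (c.1 0) ≠ ini e
  · have hc' : ter e = ini (c'.1 0) ∧ ter (c'.1 0) ≠ ini e := h₀ ▸ hc
    rw [dif_pos hc, dif_pos hc']
    refine hF _ _ fun i hi => ?_
    cases i with
    | zero => rfl
    | succ i => exact h i (by omega)
  · have hc' : ¬(ter e = ini (c'.1 0) ∧ ter (c'.1 0) ≠ ini e) := h₀ ▸ hc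
    rw [dif_neg hc, dif_neg hc']

lemma cylFun_mono {m n : ℕ} (h : m ≤ n) : cylFun G m ⊆ cylFun G n :=
  fun _ hF c c' hc => hF c c' fun i hi => hc i (hi.trans_le h)

lemma isLocallyConstant_of_mem_cylFun {F : ChainSp G → ℂ} {N : ℕ} (hF : F ∈ cylFun G N) :
    IsLocallyConstant F := by
  refine (IsLocallyConstant.iff_exists_open F).2 fun c =>
    ⟨{c' | ∀ i ≤ N, c'.1 i = c.1 i}, TopologicalSpace.isOpen_generateFrom_of_mem ⟨c, N, rfl⟩,
      fun _ _ => rfl, fun c' hc' => hF _ _ fun i hi => hc' i hi.le⟩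

lemma exists_cylinder_subset {U : Set (ChainSp G)} (hU : IsOpen U) {c : ChainSp G} (hc : c ∈ U) :
    ∃ n, {c' : ChainSp G | ∀ i ≤ n, c'.1 i = c.1 i} ⊆ U := by
  induction hU with
  | basic s hs =>
    obtain ⟨c₀, n, rfl⟩ := hs
    exact ⟨n, fun c' hc' i hi => (hc' i hi).trans (hc i hi)⟩
  | univ => exact ⟨0, Set.subset_univ _⟩
  | inter s t _ _ ihs iht =>
    obtain ⟨m, hm⟩ := ihs hc.1
    obtain ⟨n, hn⟩ := iht hc.2
    exact ⟨max m n, fun c' hc' => ⟨hm fun i hi => hc' i (hi.trans (le_max_left _ _)),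
      hn fun i hi => hc' i (hi.trans (le_max_right _ _))⟩⟩
  | sUnion S _ ih =>
    obtain ⟨s, hs, hcs⟩ := hc
    obtain ⟨n, hn⟩ := ih s hs hcs
    exact ⟨n, hn.trans (Set.subset_sUnion_of_mem hs)⟩

lemma exists_mem_cylFun [Finite (DE G)] {F : ChainSp G → ℂ} (hF : IsLocallyConstant F) :
    ∃ N, F ∈ cylFun G N := by
  let _ : TopologicalSpace (DE G) := ⊥
  have : DiscreteTopology (DE G) := ⟨rfl⟩
  have hclosed : IsClosed {c : ℕ → DE G | IsChainSeq G c} := by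
    simp only [IsChainSeq, Set.ofPred_forall]
    refine isClosed_iInter fun i => ?_
    have hcont : Continuous fun c : ℕ → DE G => (c i, c (i + 1)) :=
      (continuous_apply i).prodMk (continuous_apply (i + 1))
    exact (isClosed_discrete
      {p : DE G × DE G | ter p.1 = ini p.2 ∧ ter p.2 ≠ ini p.1}).preimage hcont
  have hloc : ∀ c : ChainSp G, ∃ n, ∀ c' : ChainSp G, (∀ i ≤ n, c'.1 i = c.1 i) → F c' = F c := by
    intro c
    obtain ⟨U, hU, hcU, hFU⟩ := (IsLocallyConstant.iff_exists_open F).1 hF c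
    obtain ⟨n, hn⟩ := exists_cylinder_subset hU hcU
    exact ⟨n, fun c' hc' => hFU c' (hn hc')⟩
  choose n hn using hloc
  obtain ⟨t, ht⟩ := hclosed.isCompact.elim_finite_subcover
    (fun c : ChainSp G => {c' : ℕ → DE G | ∀ i ≤ n c, c' i = c.1 i})
    (fun c => by
      have : {c' : ℕ → DE G | ∀ i ≤ n c, c' i = c.1 i}
          = (Set.Iic (n c)).pi fun i => {c.1 i} := by
        ext; simp [Set.mem_pi]
      rw [this]
      exact isOpen_set_pi (Set.finite_Iic _) fun _ _ => isOpen_discrete _)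
    (fun c hc => Set.mem_iUnion.2 ⟨⟨c, hc⟩, fun _ _ => rfl⟩)
  refine ⟨t.sup n + 1, fun c c' h => ?_⟩
  obtain ⟨d, hd, hcd⟩ := Set.mem_iUnion₂.1 (ht c.2)
  have hle : n d ≤ t.sup n := Finset.le_sup hd
  rw [hn d c hcd, hn d c' fun i hi => (h i (by omega)).symm.trans (hcd i hi)]

lemma exists_next (hnd : ∀ x : X, 2 ≤ deg G x) (e : DE G) :
    ∃ e' : DE G, ter e = ini e' ∧ ter e' ≠ ini e := by
  obtain ⟨e', he', hne⟩ := Set.exists_ne_of_one_lt_ncard (hnd (ter e)) (op e)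
  exact ⟨e', he'.symm, fun h => hne (edge_ext he' h)⟩

lemma exists_chain (hnd : ∀ x : X, 2 ≤ deg G x) (e : DE G) : ∃ c : ChainSp G, c.1 0 = e := by
  choose next hnext using exists_next hnd
  refine ⟨⟨fun n => next^[n] e, fun i => ?_⟩, rfl⟩
  simp only [iterate_succ_apply']
  exact hnext _

lemma exists_edge (hnd : ∀ x : X, 2 ≤ deg G x) (x : X) : ∃ e : DE G, ini e = x := by
  obtain ⟨e, he⟩ := Set.nonempty_of_ncard_ne_zero (s := {e : DE G | ini e = x})
    (by have := hnd x; unfold deg at this; omega)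
  exact ⟨e, he⟩

lemma transfer_isLocallyConstant [Fintype (DE G)] {F : ChainSp G → ℂ} (hF : IsLocallyConstant F) :
    IsLocallyConstant (transfer G F) := by
  obtain ⟨N, hN⟩ := exists_mem_cylFun hF
  exact isLocallyConstant_of_mem_cylFun
    (transfer_mem_cylFun (cylFun_mono (Nat.le_add_right N 2) hN))

variable (G) in
/-- The transfer operator as an endomorphism of the space of locally constant functions. -/
noncomputable def transferLin [Fintype (DE G)] : ClcP G →ₗ[ℂ] ClcP G where
  toFun F := ⟨transfer G F.1, transfer_isLocallyConstant F.2⟩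
  map_add' F F' := by
    refine Subtype.ext (funext fun c => ?_)
    simp only [transfer_eq_sum, Submodule.coe_add, Pi.add_apply, ← Finset.sum_add_distrib]
    refine Finset.sum_congr rfl fun e _ => ?_
    split_ifs <;> simp
  map_smul' a F := by
    refine Subtype.ext (funext fun c => ?_)
    simp only [transfer_eq_sum, Submodule.coe_smul, Pi.smul_apply, smul_eq_mul, Finset.mul_sum,
      RingHom.id_apply]
    refine Finset.sum_congr rfl fun e _ => ?_
    split_ifs <;> simp

variable (G) in
/-- Locally constant functions that depend only on the first edge of a chain. -/
noncomputable def firstEdgeFun : Submodule ℂ (ClcP G) where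
  carrier := {F | F.1 ∈ cylFun G 1}
  add_mem' hF hF' c c' h := by simp [hF c c' h, hF' c c' h]
  zero_mem' _ _ _ := rfl
  smul_mem' a F hF c c' h := by simp [hF c c' h]

lemma finiteDimensional_firstEdgeFun [Finite (DE G)] (hnd : ∀ x : X, 2 ≤ deg G x) :
    FiniteDimensional ℂ (firstEdgeFun G) := by
  choose ch hch using exists_chain hnd
  let ev : firstEdgeFun G →ₗ[ℂ] (DE G → ℂ) :=
    { toFun := fun F e => F.1.1 (ch e)
      map_add' := fun _ _ => rfl
      map_smul' := fun _ _ => rfl }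
  refine Module.Finite.of_injective ev fun F F' h => ?_
  refine Subtype.ext (Subtype.ext (funext fun c => ?_))
  have hc : ∀ i < 1, c.1 i = (ch (c.1 0)).1 i := by
    intro i hi
    obtain rfl : i = 0 := by omega
    exact (hch _).symm
  rw [F.2 _ _ hc, F'.2 _ _ hc]
  exact congrFun h (c.1 0)

lemma transferLin_pow_mem [Fintype (DE G)] (n : ℕ) (F : ClcP G) (hF : F.1 ∈ cylFun G (n + 1)) :
    (transferLin G ^ n) F ∈ firstEdgeFun G := by
  induction n generalizing F with
  | zero => exact hF
  | succ n ih =>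
    rw [pow_succ, Module.End.mul_apply]
    exact ih _ (transfer_mem_cylFun hF)

lemma exists_transferLin_pow_mem [Fintype (DE G)] (F : ClcP G) :
    ∃ n, (transferLin G ^ n) F ∈ firstEdgeFun G := by
  obtain ⟨N, hN⟩ := exists_mem_cylFun F.2
  exact ⟨N, transferLin_pow_mem N F (cylFun_mono N.le_succ hN)⟩

/-- A locally constant eigenfunction for a non-zero eigenvalue depends only on the first edge. -/
lemma mem_cylFun_one_of_transfer_eq [Fintype (DE G)] {F : ChainSp G → ℂ}
    (hF : IsLocallyConstant F) {z : ℂ} (hz : z ≠ 0) (h : ∀ c, transfer G F c = z * F c) :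
    F ∈ cylFun G 1 := by
  obtain ⟨N, hN⟩ := exists_mem_cylFun hF
  replace hN := cylFun_mono N.le_succ hN
  induction N with
  | zero => exact hN
  | succ N ih =>
    refine ih fun c c' hc => mul_left_cancel₀ hz ?_
    rw [← h, ← h]
    exact transfer_mem_cylFun hN c c' hc

lemma transfer_firstEdge [Fintype (DE G)] (f : DE G → ℂ) (c : ChainSp G) :
    transfer G (fun c => f (c.1 0)) c =
      ∑ e : DE G with ini e = ini (c.1 0), f (op e) - f (op (c.1 0)) := by
  have hmem : c.1 0 ∈ ({e : DE G | ini e = ini (c.1 0)} : Finset (DE G)) := by simp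
  rw [transfer_eq_sum, ← Finset.sum_erase_eq_sub (f := fun e => f (op e)) hmem]
  have hop : Involutive (op : DE G → DE G) := op_op
  rw [← Equiv.sum_comp hop.toPerm, ← Finset.sum_subset (Finset.subset_univ _)]
  · refine Finset.sum_congr rfl fun e he => ?_
    obtain ⟨hne, he⟩ := Finset.mem_erase.1 he
    replace he : ini e = ini (c.1 0) := (Finset.mem_filter.1 he).2
    exact dif_pos ⟨he, fun h => hne (edge_ext he h.symm)⟩
  · intro e _ he
    refine dif_neg fun h => he (Finset.mem_erase.2 ⟨?_, Finset.mem_filter.2 ⟨Finset.mem_univ _, h.1⟩⟩)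
    rintro rfl
    exact h.2 rfl

end Chains

section Vertex

variable {G} [Fintype (DE G)]

lemma deg_eq_card (x : X) : (deg G x) = (Finset.card {e : DE G | ini e = x}) := by
  rw [deg, Set.ncard_eq_toFinset_card', Set.toFinset_ofPred]

/-- The eigenvalue equation with the denominators cleared. -/
lemma mem_vertexEig_iff (hnd : ∀ x : X, 2 ≤ deg G x) {z : ℂ} (hz : z ≠ 0) (p : X → ℂ) :
    p ∈ vertexEig G z ↔ ∀ x, z * ∑ e : DE G with ini e = x, p (ter e)
      = (z ^ 2 + ((deg G x : ℂ) - 1)) * p x := by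
  refine forall_congr' fun x => ?_
  have hd : (deg G x : ℂ) ≠ 0 := by
    have := hnd x
    exact_mod_cast (by omega : deg G x ≠ 0)
  have hsum : ∑ᶠ e ∈ {e : DE G | ini e = x}, p (ter e)
      = ∑ e : DE G with ini e = x, p (ter e) := by
    rw [← finsum_mem_coe_finset]
    simp
  rw [vertexLap, chi, hsum]
  constructor
  · intro h
    field_simp at h
    linear_combination h
  · intro h
    field_simp
    linear_combination h

/-- The function on chains attached to a function on vertices. -/
def vertexToChain (z : ℂ) (p : X → ℂ) (c : ChainSp G) : ℂ :=
  z * p (ini (c.1 0)) - p (ter (c.1 0))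

lemma transfer_vertexToChain (z : ℂ) (p : X → ℂ) (c : ChainSp G) :
    transfer G (vertexToChain z p) c = z * ∑ e : DE G with ini e = ini (c.1 0), p (ter e)
      - deg G (ini (c.1 0)) * p (ini (c.1 0)) - z * p (ter (c.1 0)) + p (ini (c.1 0)) := by
  refine (transfer_firstEdge (fun e => z * p (ini e) - p (ter e)) c).trans ?_
  have h : ∑ e : DE G with ini e = ini (c.1 0), p (ini e)
      = deg G (ini (c.1 0)) * p (ini (c.1 0)) := by
    rw [deg_eq_card, ← nsmul_eq_mul]
    exact Finset.sum_eq_card_nsmul fun e he => by rw [(Finset.mem_filter.1 he).2]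
  simp only [ini_op, ter_op, Finset.sum_sub_distrib, ← Finset.mul_sum, h]
  ring

lemma bijOn_vertexToChain (hnd : ∀ x : X, 2 ≤ deg G x) {z : ℂ} (hz0 : z ≠ 0) (hz1 : z ≠ 1)
    (hzm1 : z ≠ -1) :
    Set.BijOn (vertexToChain z) (vertexEig G z)
      {F : ChainSp G → ℂ | IsLocallyConstant F ∧ ∀ c, transfer G F c = z * F c} := by
  have hz : z ^ 2 - 1 ≠ 0 := by
    rw [show z ^ 2 - 1 = (z - 1) * (z + 1) by ring]
    exact mul_ne_zero (sub_ne_zero.2 hz1) (by rwa [← sub_neg_eq_add, sub_ne_zero])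
  refine ⟨fun p hp => ⟨?_, fun c => ?_⟩, fun p _ p' _ h => ?_, fun F hF => ?_⟩
  · refine isLocallyConstant_of_mem_cylFun (N := 1) fun c c' h => ?_
    simp only [vertexToChain, h 0 one_pos]
  · rw [mem_vertexEig_iff hnd hz0] at hp
    rw [transfer_vertexToChain, hp, vertexToChain]
    ring
  · have hedge : ∀ e : DE G, z * p (ini e) - p (ter e) = z * p' (ini e) - p' (ter e) := by
      intro e
      obtain ⟨c, rfl⟩ := exists_chain hnd e
      exact congrFun h c
    funext x
    obtain ⟨e, rfl⟩ := exists_edge hnd x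
    have h₁ := hedge e
    have h₂ := hedge (op e)
    simp only [ini_op, ter_op] at h₂
    refine mul_left_cancel₀ hz ?_
    linear_combination z * h₁ + h₂
  · obtain ⟨hlc, hF⟩ := hF
    choose ch hch using exists_chain hnd
    set f : DE G → ℂ := fun e => F (ch e) with hf
    have hFf : F = fun c => f (c.1 0) := by
      funext c
      refine mem_cylFun_one_of_transfer_eq hlc hz0 hF _ _ fun i hi => ?_
      obtain rfl : i = 0 := by omega
      exact (hch _).symm
    set s : X → ℂ := fun x => ∑ e : DE G with ini e = x, f (op e) with hs
    have hsf : ∀ e : DE G, s (ini e) - f (op e) = z * f e := by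
      intro e
      obtain ⟨c, rfl⟩ := exists_chain hnd e
      have h := hF c
      rw [hFf, transfer_firstEdge] at h
      exact h
    have hfs : ∀ e : DE G, (z ^ 2 - 1) * f e = z * s (ini e) - s (ter e) := by
      intro e
      have h₁ := hsf e
      have h₂ := hsf (op e)
      simp only [ini_op, op_op] at h₂
      linear_combination h₂ - z * h₁
    refine ⟨fun x => (z ^ 2 - 1)⁻¹ * s x, (mem_vertexEig_iff hnd hz0 _).2 fun x => ?_, ?_⟩
    · have h : (z ^ 2 - 1) * s x = z * (∑ e : DE G with ini e = x, s (ter e)) - deg G x * s x := by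
        have h' : ∑ e : DE G with ini e = x, s (ini e) = deg G x * s x := by
          rw [deg_eq_card, ← nsmul_eq_mul]
          exact Finset.sum_eq_card_nsmul fun e he => by rw [(Finset.mem_filter.1 he).2]
        rw [← h', Finset.mul_sum _ _ z, ← Finset.sum_sub_distrib]
        refine (Finset.mul_sum _ _ _).trans ?_
        exact Finset.sum_congr rfl fun e _ => hfs (op e)
      rw [← Finset.mul_sum]
      linear_combination -(z ^ 2 - 1)⁻¹ * h
    · rw [hFf]
      funext c
      refine mul_left_cancel₀ hz ?_
      rw [hfs, vertexToChain]
      field_simp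

end Vertex

section Dual

variable {G} [Fintype (DE G)]

lemma coe_map_ker_transferLin (z : ℂ) :
    (((LinearMap.ker (transferLin G - z • LinearMap.id)).map (ClcP G).subtype :
      Submodule ℂ (ChainSp G → ℂ)) : Set (ChainSp G → ℂ)) =
      {F | IsLocallyConstant F ∧ ∀ c, transfer G F c = z * F c} := by
  ext F
  simp only [Submodule.map_coe, Set.mem_image, SetLike.mem_coe, LinearMap.mem_ker,
    LinearMap.sub_apply, LinearMap.smul_apply, LinearMap.id_apply, sub_eq_zero, Set.mem_ofPred_eq]
  constructor
  · rintro ⟨F, hF, rfl⟩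
    exact ⟨F.2, fun c => congrFun (congrArg Subtype.val hF) c⟩
  · rintro ⟨hlc, hF⟩
    exact ⟨⟨F, hlc⟩, Subtype.ext (funext hF), rfl⟩

lemma coe_ker_dualMap_transferLin (z : ℂ) :
    ((LinearMap.ker (transferLin G - z • LinearMap.id).dualMap : Submodule ℂ (DualPc G)) :
      Set (DualPc G)) =
      {lam | ∀ f : ↥(ClcP G), pairPc G lam (transfer G f.1) = z * lam f} := by
  ext lam
  rw [SetLike.mem_coe, LinearMap.mem_ker, LinearMap.ext_iff]
  refine forall_congr' fun f => ?_
  have h : pairPc G lam (transfer G f.1) = lam (transferLin G f) :=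
    dif_pos (transfer_isLocallyConstant f.2)
  rw [h, LinearMap.dualMap_apply, LinearMap.sub_apply, map_sub, LinearMap.zero_apply, sub_eq_zero,
    LinearMap.smul_apply, map_smul, LinearMap.id_apply, smul_eq_mul]

lemma areLinIso_dual (hnd : ∀ x : X, 2 ≤ deg G x) {z : ℂ} (hz0 : z ≠ 0) :
    AreLinIso {F : ChainSp G → ℂ | IsLocallyConstant F ∧ ∀ c, transfer G F c = z * F c}
      {lam : DualPc G | ∀ f : ↥(ClcP G), pairPc G lam (transfer G f.1) = z * lam f} := by
  have := finiteDimensional_firstEdgeFun hnd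
  obtain ⟨e⟩ := nonempty_ker_equiv_ker_dualMap (transferLin G) (firstEdgeFun G)
    (fun F hF => transfer_mem_cylFun (cylFun_mono one_le_two hF)) exists_transferLin_pow_mem hz0
  rw [← coe_map_ker_transferLin, ← coe_ker_dualMap_transferLin]
  exact areLinIso_of_equiv
    ((Submodule.equivMapOfInjective _ (ClcP G).injective_subtype _).symm.trans e)

end Dual

/-- Regular quantum-classical correspondence for finite graphs: for
`z ∉ {-1, 0, 1}` the spaces `E_{χ(z)}(Δ)`, `E_z(L; C^lc(𝔓))` and `E_z(L'; D'(𝔓))` are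
pairwise linearly isomorphic. -/
theorem statement12 {X : Type} [Finite X] (G : SimpleGraph X) (hconn : G.Connected)
    (hnd : ∀ x : X, 2 ≤ deg G x) (z : ℂ) (hz0 : z ≠ 0) (hz1 : z ≠ 1) (hzm1 : z ≠ -1) :
    AreLinIso (vertexEig G z)
      {F : ChainSp G → ℂ | IsLocallyConstant F ∧ ∀ c, transfer G F c = z * F c} ∧
    AreLinIso {F : ChainSp G → ℂ | IsLocallyConstant F ∧ ∀ c, transfer G F c = z * F c}
      {lam : DualPc G | ∀ f : ↥(ClcP G), pairPc G lam (transfer G f.1) = z * lam f} ∧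
    AreLinIso (vertexEig G z)
      {lam : DualPc G | ∀ f : ↥(ClcP G), pairPc G lam (transfer G f.1) = z * lam f} := by
  have := Fintype.ofFinite (DE G)
  have h₁ : AreLinIso (vertexEig G z)
      {F : ChainSp G → ℂ | IsLocallyConstant F ∧ ∀ c, transfer G F c = z * F c} := by
    refine ⟨vertexToChain z, bijOn_vertexToChain hnd hz0 hz1 hzm1, fun p _ p' _ => ?_,
      fun a p _ => ?_⟩
    · funext c
      simp only [vertexToChain, Pi.add_apply]
      ring
    · funext c
      simp only [vertexToChain, Pi.smul_apply, smul_eq_mul]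
      ring
  have h₂ := areLinIso_dual hnd hz0
  exact ⟨h₁, h₂, h₁.trans h₂⟩

end GraphQCC
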